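/- arXiv:0902.0451 — 3 statements merged into one kernel-verified Lean document; each statement's English description precedes it below -/
import Mathlib

section
/- Let 𝒩 > 0 be real, n ∈ ℕ, and set ν := 𝒩 + 1/2 − n. Assume ν > 0. Then for every X ∈ ℝ, ℋ_n^𝒩(X·√𝒩) = α_{n,ν} · n! · (ν/𝒩)^{n/2} · (1 + X²)^{n/2} · 𝒞_n^ν(X√ν / √(1 + X²)). (Note that X√ν/√(1+X²) ∈ (−√ν, √ν), so the right-hand side is well defined.) -/
open Real MeasureTheory Filter

/-- Relativistic Hermite polynomial via its Rodrigues formula. -/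
noncomputable def relHermite (n : ℕ) (N : ℝ) (X : ℝ) : ℝ :=
  (-1 : ℝ)^n * (1 + X^2/N)^(N + (n : ℝ)) *
    iteratedDeriv n (fun t : ℝ => (1 + t^2/N)^(-N)) X

/-- Cariñena polynomial with positive parameter via its Rodrigues formula. -/
noncomputable def carinenaPos (n : ℕ) (𝒩 : ℝ) (X : ℝ) : ℝ :=
  (-1 : ℝ)^n * (1 + X^2/𝒩)^(𝒩 + 1/2) *
    iteratedDeriv n (fun t : ℝ => (1 + t^2/𝒩)^((n : ℝ) - 𝒩 - 1/2)) X

/-- Cariñena polynomial with negative parameter 𝒩 = -ν via its Rodrigues formula. -/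
noncomputable def carinenaNeg (n : ℕ) (ν : ℝ) (X : ℝ) : ℝ :=
  (-1 : ℝ)^n * (1 - X^2/ν)^((1:ℝ)/2 - ν) *
    iteratedDeriv n (fun t : ℝ => (1 - t^2/ν)^((n : ℝ) + ν - 1/2)) X

/-- The constant α_{n,ν} = (2ν)_n / (2^n n! (ν+1/2)_n). -/
noncomputable def alphaConst (n : ℕ) (ν : ℝ) : ℝ :=
  (ascPochhammer ℝ n).eval (2*ν) /
    (2^n * (n.factorial : ℝ) * (ascPochhammer ℝ n).eval (ν + 1/2))

/-- Gegenbauer polynomial via its Rodrigues formula. -/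
noncomputable def gegenbauer (n : ℕ) (ν : ℝ) (X : ℝ) : ℝ :=
  alphaConst n ν * (-1 : ℝ)^n * (1 - X^2)^((1:ℝ)/2 - ν) *
    iteratedDeriv n (fun t : ℝ => (1 - t^2)^((n : ℝ) + ν - 1/2)) X

/-- The iterated derivatives of `(1 + σ t²)^a`. -/
noncomputable def carD (σ a : ℝ) (k : ℕ) : ℝ → ℝ :=
  iteratedDeriv k (fun t : ℝ => (1 + σ * t^2)^a)

lemma carD_hasDerivAt (σ a : ℝ) (k : ℕ) (t : ℝ) (ht : 0 < 1 + σ * t^2) :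
    HasDerivAt (carD σ a k) (carD σ a (k+1) t) t := by
  have h : ContDiffAt ℝ (k+1 : ℕ) (fun t : ℝ => (1 + σ * t^2)^a) t := by
    apply ContDiffAt.rpow_const_of_ne
    · fun_prop
    · exact ht.ne'
  have hd : DifferentiableAt ℝ (carD σ a k) t :=
    by
    rw [carD, ← iteratedDerivWithin_univ, ← differentiableWithinAt_univ]
    exact ContDiffWithinAt.differentiableWithinAt_iteratedDerivWithin (n := (k+1 : ℕ))
      h.contDiffWithinAt (by exact_mod_cast Nat.lt_succ_self k)
      (by simpa using uniqueDiffOn_univ)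
  have := hd.hasDerivAt
  unfold carD at this ⊢
  rwa [iteratedDeriv_succ]

lemma car_deriv_eq {σ : ℝ} {g h : ℝ → ℝ} (heq : ∀ t, 0 < 1 + σ * t^2 → g t = h t)
    {t g' h' : ℝ} (ht : 0 < 1 + σ * t^2) (hg : HasDerivAt g g' t) (hh : HasDerivAt h h' t) :
    g' = h' := by
  have ho : IsOpen {t : ℝ | 0 < 1 + σ * t^2} := isOpen_lt (by fun_prop) (by fun_prop)
  have : g =ᶠ[nhds t] h := by
    filter_upwards [ho.mem_nhds ht] with s hs using heq s hs
  exact hg.unique (hh.congr_of_eventuallyEq this)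

lemma car_quad (σ t : ℝ) : HasDerivAt (fun t : ℝ => 1 + σ * t^2) (2 * σ * t) t := by
  have := ((hasDerivAt_pow 2 t).const_mul σ).const_add 1
  exact this.congr_deriv (by norm_num; ring)

lemma carD_zero (σ a t : ℝ) : carD σ a 0 t = (1 + σ * t^2)^a := by simp [carD]

lemma carD_one (σ a t : ℝ) (ht : 0 < 1 + σ * t^2) :
    carD σ a 1 t = 2 * a * σ * t * (1 + σ * t^2)^(a-1) := by
  refine (carD_hasDerivAt σ a 0 t ht).unique ?_
  have := (car_quad σ t).rpow_const (p := a) (Or.inl ht.ne')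
  have e : carD σ a 0 = fun t => (1 + σ * t^2)^a := by ext; exact carD_zero _ _ _
  rw [e]
  exact this.congr_deriv (by ring)

lemma carD_three_zero (σ a t : ℝ) (ht : 0 < 1 + σ * t^2) :
    (1 + σ * t^2) * carD σ a 1 t = 2 * a * σ * (t * carD σ a 0 t) := by
  rw [carD_one σ a t ht, carD_zero, Real.rpow_sub_one ht.ne']
  field_simp

lemma carD_three (σ a : ℝ) (k : ℕ) : ∀ t : ℝ, 0 < 1 + σ * t^2 →
    (1 + σ * t^2) * carD σ a (k+2) t =
      2 * a * σ * (t * carD σ a (k+1) t + (k+1) * carD σ a k t)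
      - 2 * (k+1) * σ * (t * carD σ a (k+1) t) - (k+1) * k * σ * carD σ a k t := by
  induction k with
  | zero =>
    intro t ht
    have h0 := carD_hasDerivAt σ a 0 t ht
    have h1 := carD_hasDerivAt σ a 1 t ht
    have := car_deriv_eq (carD_three_zero σ a) ht ((car_quad σ t).mul h1)
      (((hasDerivAt_id t).mul h0).const_mul (2 * a * σ))
    simp at this ⊢
    linear_combination this
  | succ k ih =>
    intro t ht
    have h0 := carD_hasDerivAt σ a k t ht
    have h1 := carD_hasDerivAt σ a (k+1) t ht
    have h2 := carD_hasDerivAt σ a (k+2) t ht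
    have ht1 := (hasDerivAt_id t).mul h1
    have := car_deriv_eq ih ht ((car_quad σ t).mul h2)
      ((((ht1.add (h0.const_mul ((k:ℝ)+1))).const_mul (2 * a * σ)).sub
        (ht1.const_mul (2 * (k+1) * σ))).sub (h0.const_mul (((k:ℝ)+1) * k * σ)))
    simp at this
    push_cast
    linear_combination this

lemma carD_up_one (σ a t : ℝ) (ht : 0 < 1 + σ * t^2) :
    carD σ (a+1) 1 t = 2 * (a+1) * σ * (t * carD σ a 0 t) := by
  rw [carD_one σ _ t ht, carD_zero]
  simp; ring

lemma carD_up (σ a : ℝ) (k : ℕ) : ∀ t : ℝ, 0 < 1 + σ * t^2 →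
    carD σ (a+1) (k+2) t =
      2 * (a+1) * σ * (t * carD σ a (k+1) t + (k+1) * carD σ a k t) := by
  induction k with
  | zero =>
    intro t ht
    have h0 := carD_hasDerivAt σ a 0 t ht
    have h1 := carD_hasDerivAt σ (a+1) 1 t ht
    have := car_deriv_eq (carD_up_one σ a) ht h1
      (((hasDerivAt_id t).mul h0).const_mul (2 * (a+1) * σ))
    simp at this ⊢
    linear_combination this
  | succ k ih =>
    intro t ht
    have h0 := carD_hasDerivAt σ a k t ht
    have h1 := carD_hasDerivAt σ a (k+1) t ht
    have h2 := carD_hasDerivAt σ (a+1) (k+2) t ht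
    have := car_deriv_eq ih ht h2
      ((((hasDerivAt_id t).mul h1).add (h0.const_mul ((k:ℝ)+1))).const_mul (2 * (a+1) * σ))
    simp at this
    push_cast
    linear_combination this

lemma carD_mul_zero (σ a t : ℝ) (ht : 0 < 1 + σ * t^2) :
    carD σ (a+1) 0 t = (1 + σ * t^2) * carD σ a 0 t := by
  rw [carD_zero, carD_zero, Real.rpow_add_one ht.ne']; ring

lemma carD_mul_one (σ a t : ℝ) (ht : 0 < 1 + σ * t^2) :
    carD σ (a+1) 1 t = (1 + σ * t^2) * carD σ a 1 t + 2 * σ * (t * carD σ a 0 t) := by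
  have := car_deriv_eq (carD_mul_zero σ a) ht (carD_hasDerivAt σ (a+1) 0 t ht)
    ((car_quad σ t).mul (carD_hasDerivAt σ a 0 t ht))
  simp at this
  linear_combination this

lemma carD_mul (σ a : ℝ) (k : ℕ) : ∀ t : ℝ, 0 < 1 + σ * t^2 →
    carD σ (a+1) (k+2) t = (1 + σ * t^2) * carD σ a (k+2) t
      + 2 * (k+2) * σ * (t * carD σ a (k+1) t) + (k+2) * (k+1) * σ * carD σ a k t := by
  induction k with
  | zero =>
    intro t ht
    have h0 := carD_hasDerivAt σ a 0 t ht
    have h1 := carD_hasDerivAt σ a 1 t ht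
    have := car_deriv_eq (carD_mul_one σ a) ht (carD_hasDerivAt σ (a+1) 1 t ht)
      (((car_quad σ t).mul h1).add (((hasDerivAt_id t).mul h0).const_mul (2 * σ)))
    simp at this ⊢
    linear_combination this
  | succ k ih =>
    intro t ht
    have h0 := carD_hasDerivAt σ a k t ht
    have h1 := carD_hasDerivAt σ a (k+1) t ht
    have h2 := carD_hasDerivAt σ a (k+2) t ht
    have := car_deriv_eq ih ht (carD_hasDerivAt σ (a+1) (k+2) t ht)
      ((((car_quad σ t).mul h2).add (((hasDerivAt_id t).mul h1).const_mul (2 * (k+2) * σ))).add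
        (h0.const_mul (((k:ℝ)+2) * (k+1) * σ)))
    simp at this
    push_cast
    linear_combination this

lemma carD_B (σ μ : ℝ) (n : ℕ) (t : ℝ) (ht : 0 < 1 + σ * t^2) :
    (n + 2 * μ + 3) * carD σ ((n+1+μ)+1) (n+1) t =
      2 * (n + μ + 2) * ((1 + σ * t^2) * carD σ (n+1+μ) (n+1) t
        + (n+1) * σ * (t * carD σ (n+1+μ) n t)) := by
  cases n with
  | zero =>
    have h1 := carD_mul_one σ (((0:ℕ):ℝ)+1+μ) t ht
    have h2 := carD_three_zero σ (((0:ℕ):ℝ)+1+μ) t ht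
    simp only [Nat.cast_zero, zero_add] at *
    linear_combination (2*μ+3) * h1 - h2
  | succ m =>
    have h1 := carD_mul σ (((m+1:ℕ):ℝ)+1+μ) m t ht
    have h2 := carD_three σ (((m+1:ℕ):ℝ)+1+μ) m t ht
    push_cast at *
    linear_combination ((m:ℝ)+1+2*μ+3) * h1 - ((m:ℝ)+2) * h2

/-- Normalised polynomial sequence. -/
noncomputable def carQ (ν y : ℝ) : ℕ → ℝ
  | 0 => 1
  | 1 => -2 * ν * y
  | (n+2) => -2 * (n + 1 + ν) * y * carQ ν y (n+1) - (n+1) * (n + 2 * ν) * carQ ν y n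

noncomputable def carK (ν : ℝ) : ℕ → ℝ
  | 0 => 1
  | (n+1) => carK ν n * ((2 * ν + n) / (2 * (ν + 1/2 + n)))

lemma carK_eq (ν : ℝ) (n : ℕ) : alphaConst n ν * (n.factorial : ℝ) = carK ν n := by
  have hf : ∀ n : ℕ, (n.factorial : ℝ) ≠ 0 := fun n => by exact_mod_cast n.factorial_ne_zero
  have : ∀ n : ℕ, carK ν n = (ascPochhammer ℝ n).eval (2*ν) /
      (2^n * (ascPochhammer ℝ n).eval (ν + 1/2)) := by
    intro n
    induction n with
    | zero => simp [carK]
    | succ n ih =>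
      rw [carK, ih, ascPochhammer_succ_eval, ascPochhammer_succ_eval, div_mul_div_comm]
      congr 1
      ring
  rw [this, alphaConst]
  rw [show (2:ℝ)^n * (n.factorial : ℝ) * (ascPochhammer ℝ n).eval (ν + 1/2) =
    (2^n * (ascPochhammer ℝ n).eval (ν + 1/2)) * n.factorial by ring, div_mul_eq_div_div,
    div_mul_cancel₀ _ (hf n)]

/-- Positive side. `r² = 1 + X²`, `s² = N`, `X = r y`, and `t = X s`. -/
lemma car_pos_side (N ν r s y t : ℝ) (hs : 0 < s) (hN : N = s^2) (hr : 0 < r)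
    (ht : t = r * y * s) (hr2 : r^2 = 1 + (r*y)^2) (n : ℕ) :
    carD (1/N) (-ν) n t * (r * s)^n = (r^2)^(-ν) * carQ ν y n := by
  have hv : 1 + 1/N * t^2 = r^2 := by
    rw [hr2, hN, ht]; field_simp
  have hpos : 0 < 1 + 1/N * t^2 := by rw [hv]; positivity
  induction n using Nat.twoStepInduction with
  | zero => rw [carD_zero, hv]; simp [carQ]
  | one =>
    have h := carD_three_zero (1/N) (-ν) t hpos
    rw [carD_zero, hv, ht, hN] at h
    rw [ht, hN] 
    simp only [carQ]
    field_simp at h ⊢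
    linear_combination h
  | more n ih1 ih2 =>
    have h := carD_three (1/N) (-ν) n t hpos
    rw [hv] at h
    have e : 1/N * t = r * y / s := by rw [hN, ht]; field_simp
    have e2 : 1/N * s^2 = 1 := by rw [hN]; field_simp
    have e3 : 1/N * t * s = r * y := by rw [e]; field_simp
    simp only [carQ]
    have : carD (1/N) (-ν) (n+2) t * (r*s)^(n+2) = (r^2 * carD (1/N) (-ν) (n+2) t) * (r*s)^n * s^2 := by
      ring
    rw [this, h]
    generalize carD (1/N) (-ν) (n+1) t = F1 at *
    generalize carD (1/N) (-ν) n t = F0 at *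
    generalize 1/N = σ at *
    have ih2' : F1 * (r * s)^n * (r*s) = (r^2)^(-ν) * carQ ν y (n+1) := by rw [← ih2]; ring
    generalize (r*s)^n = G at *
    linear_combination (-2 * (n+1+ν)) * F1 * G * s * e3 - (n+1)*(n+2*ν) * F0 * G * e2
      + (-2 * (n+1+ν)) * y * ih2' - (n+1)*(n+2*ν) * ih1

/-- Negative side. -/
lemma car_neg_side (ν s y u : ℝ) (hs : 0 < s) (hν : ν = s^2) (hu : u = 1 - y^2) (hupos : 0 < u)
    (n : ℕ) :
    carK ν n * carD (-1/ν) (n + (ν - 1/2)) n (y * s) * s^n = u^(ν-1/2) * carQ ν y n ∧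
    carK ν (n+1) * carD (-1/ν) (n + 1 + (ν - 1/2)) (n+1) (y * s) * s^(n+1)
      = u^(ν-1/2) * carQ ν y (n+1) ∧
    (n+1+2*ν) * carK ν (n+1) * carD (-1/ν) (n + 1 + (ν - 1/2)) n (y * s) * s^n
      = u^(ν-1/2) * (y * carQ ν y (n+1) + (n + 2*ν) * carQ ν y n) := by
  have hνp : 0 < ν := by rw [hν]; positivity
  have hv : 1 + -1/ν * (y*s)^2 = u := by rw [hu, hν]; field_simp; ring
  have hpos : 0 < 1 + -1/ν * (y*s)^2 := by rw [hv]; exact hupos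
  have e2 : -1/ν * s^2 = -1 := by rw [hν]; field_simp
  induction n with
  | zero =>
    have h0 := carD_zero (-1/ν) (ν-1/2) (y*s)
    have h1 := carD_up_one (-1/ν) (ν-1/2) (y*s) hpos
    have h2 := carD_mul_zero (-1/ν) (ν-1/2) (y*s) hpos
    rw [hv] at h0 h2
    rw [h0] at h1 h2
    have ea : ((0:ℕ):ℝ) + 1 + (ν - 1/2) = ν - 1/2 + 1 := by push_cast; ring
    have eb : ((0:ℕ):ℝ) + (ν - 1/2) = ν - 1/2 := by push_cast; ring
    rw [ea, eb]
    have hk : carK ν (0+1) * (ν + 1/2) = ν := by simp only [carK]; push_cast; field_simp; ring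
    generalize carK ν (0+1) = K at *
    refine ⟨?_, ?_, ?_⟩
    · rw [h0]; simp [carQ, carK]
    · simp only [zero_add, h1, carQ]
      generalize -1/ν = σ at *
      generalize u^(ν-1/2) = w at *
      linear_combination 2 * K * (ν-1/2+1) * y * w * e2 -2 * y * w * hk
    · rw [h2]; simp only [carQ, zero_add]
      generalize -1/ν = σ at *
      generalize u^(ν-1/2) = w at *
      push_cast
      rw [hu]
      linear_combination 2 * (1-y^2) * w * hk
  | succ n ih =>
    obtain ⟨-, i1, i2⟩ := ih
    have h1 := carD_up (-1/ν) (n+1+(ν-1/2)) n (y*s) hpos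
    have h2 := carD_B (-1/ν) (ν-1/2) n (y*s) hpos
    rw [hv] at h2
    have ea : ((n+1:ℕ):ℝ) + 1 + (ν - 1/2) = n + 1 + (ν - 1/2) + 1 := by push_cast; ring
    have eb : ((n+1:ℕ):ℝ) + (ν - 1/2) = n + 1 + (ν - 1/2) := by push_cast; ring
    rw [ea, eb]
    have hn : (0:ℝ) ≤ n := Nat.cast_nonneg n
    have hk : carK ν (n+1+1) * (2 * (n + ν + 3/2)) = carK ν (n+1) * (2*ν+n+1) := by
      rw [carK]; push_cast
      have : 2 * (ν + 1/2 + (n+1)) ≠ 0 := by positivity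
      field_simp
      ring
    refine ⟨i1, ?_⟩
    have i1' : carK ν (n+1) * carD (-1/ν) (n + 1 + (ν - 1/2)) (n+1) (y * s) * s^n * s
      = u^(ν-1/2) * carQ ν y (n+1) := by rw [← i1]; ring
    have hA : carK ν (n+1+1) * carD (-1/ν) (n + 1 + (ν - 1/2) + 1) (n+1+1) (y * s) * s^(n+1+1)
      = u^(ν-1/2) * carQ ν y (n+1+1) := by
      rw [h1, carQ]
      generalize carK ν (n+1+1) = K' at *
      generalize carK ν (n+1) = K at *
      generalize carD (-1/ν) (n + 1 + (ν - 1/2)) (n+1) (y * s) = A at *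
      generalize carD (-1/ν) (n + 1 + (ν - 1/2)) n (y * s) = B at *
      generalize -1/ν = σ at *
      generalize u^(ν-1/2) = w at *
      rw [pow_succ, pow_succ]
      generalize s^n = S at *
      linear_combination σ * (y*s*A + (n+1)*B) * S * s^2 * hk
        + K * (2*ν+n+1) * (y*s*A + (n+1)*B) * S * e2
        - (2*ν+n+1) * y * i1' - (n+1) * i2
    refine ⟨hA, ?_⟩
    have hA' := hA
    rw [h1] at hA'
    generalize carQ ν y (n+1+1) = Q2 at *
    generalize carK ν (n+1+1) = K' at *
    generalize carK ν (n+1) = K at *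
    generalize carD (-1/ν) (n + 1 + (ν - 1/2)) (n+1) (y * s) = A at *
    generalize carD (-1/ν) (n + 1 + (ν - 1/2)) n (y * s) = B at *
    generalize carD (-1/ν) (n + 1 + (ν - 1/2) + 1) (n+1) (y * s) = B' at *
    generalize -1/ν = σ at *
    generalize u^(ν-1/2) = w at *
    push_cast
    rw [pow_succ, pow_succ] at hA'
    rw [pow_succ]
    generalize s^n = S at *
    subst hu
    linear_combination K' * S * s * h2 + y * hA' +
      ((1-y^2) * A + (n+1) * σ * (y*s*B)) * S * s * hk + (2*ν+n+1) * i1'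
      - y * (σ * (y*s*A + (n+1)*B) * S * s^2 * hk)
      - y * K * (2*ν+n+1) * y * s*A * S * e2

theorem carinena_pos_eq_carinena_neg (𝒩 : ℝ) (h𝒩 : 0 < 𝒩) (n : ℕ)
    (ν : ℝ) (hν : ν = 𝒩 + 1/2 - n) (hνpos : 0 < ν) (X : ℝ) :
    carinenaPos n 𝒩 (X * Real.sqrt 𝒩) =
      alphaConst n ν * (n.factorial : ℝ) * (ν/𝒩)^((n : ℝ)/2) * (1 + X^2)^((n : ℝ)/2) *
        carinenaNeg n ν (X * Real.sqrt ν / Real.sqrt (1 + X^2)) := by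
  have hX : 0 < 1 + X^2 := by positivity
  set r := Real.sqrt (1 + X^2) with hr
  set s := Real.sqrt 𝒩 with hs
  set p := Real.sqrt ν with hp
  have hrp : 0 < r := Real.sqrt_pos.2 hX
  have hsp : 0 < s := Real.sqrt_pos.2 h𝒩
  have hpp : 0 < p := Real.sqrt_pos.2 hνpos
  have hr2 : r^2 = 1 + X^2 := Real.sq_sqrt hX.le
  have hs2 : s^2 = 𝒩 := Real.sq_sqrt h𝒩.le
  have hp2 : p^2 = ν := Real.sq_sqrt hνpos.le
  obtain ⟨y, hy⟩ : ∃ y, y = X / r := ⟨_, rfl⟩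
  have hry : r * y = X := by rw [hy]; field_simp
  have hu : 1 - y^2 = (r^2)⁻¹ := by
    have : r^2 * (1 - y^2) = 1 := by linear_combination hr2 - (r*y+X)*hry
    exact eq_inv_of_mul_eq_one_right this
  have hup : 0 < 1 - y^2 := by rw [hu]; positivity
  have H1 := car_pos_side 𝒩 ν r s y (X * s) hsp hs2.symm hrp (by rw [hry]) (by rw [hry, hr2]) n
  have H2 := (car_neg_side ν p y (1 - y^2) hpp hp2.symm rfl hup n).1
  have e1 : (ν/𝒩)^((n : ℝ)/2) = (p/s)^n := by
    rw [Real.rpow_div_two_eq_sqrt _ (by positivity), Real.rpow_natCast, Real.sqrt_div hνpos.le]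
  have e2 : (1 + X^2)^((n : ℝ)/2) = r^n := by
    rw [Real.rpow_div_two_eq_sqrt _ (by positivity), Real.rpow_natCast]
  have d1 : iteratedDeriv n (fun t : ℝ => (1 + t^2/𝒩)^((n : ℝ) - 𝒩 - 1/2)) =
      carD (1/𝒩) (-ν) n := by
    unfold carD; congr 1; ext t
    congr 1
    · ring
    · rw [hν]; ring
  have d2 : iteratedDeriv n (fun t : ℝ => (1 - t^2/ν)^((n : ℝ) + ν - 1/2)) =
      carD (-1/ν) (n + (ν - 1/2)) n := by
    unfold carD; congr 1; ext t
    congr 1 <;> ring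
  have hz : X * p / r = y * p := by rw [hy]; ring
  have b1 : 1 + (X * s)^2/𝒩 = r^2 := by rw [hr2, ← hs2]; field_simp
  have b2 : 1 - (y * p)^2/ν = 1 - y^2 := by rw [← hp2]; field_simp
  rw [carK_eq, e1, e2, carinenaPos, carinenaNeg, d1, d2, hz, b1, b2]
  have hexp : (r^2)^(𝒩 + 1/2) * (r^2)^(-ν) = r^n * r^n := by
    rw [← Real.rpow_add (by positivity), hν, show 𝒩 + 1/2 + -(𝒩 + 1/2 - n) = (n:ℝ) by ring,
      Real.rpow_natCast]
    ring
  have hexp2 : (1 - y^2)^((1:ℝ)/2 - ν) * (1 - y^2)^(ν - 1/2) = 1 := by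
    rw [← Real.rpow_add hup]; simp
  have F1 : carD (1/𝒩) (-ν) n (X*s) = (r^2)^(-ν) * carQ ν y n / (r*s)^n := by
    rw [← H1]; field_simp
  have F2 : carK ν n * carD (-1/ν) (n + (ν - 1/2)) n (y * p) =
      (1-y^2)^(ν-1/2) * carQ ν y n / p^n := by
    rw [← H2]; field_simp
  calc _ = (-1)^n * ((r^2)^(𝒩 + 1/2) * (r^2)^(-ν)) * carQ ν y n / (r*s)^n := by rw [F1]; ring
    _ = (-1)^n * (p/s)^n * r^n * ((1 - y^2)^((1:ℝ)/2 - ν) * (1 - y^2)^(ν - 1/2))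
        * carQ ν y n / p^n := by
      rw [hexp, hexp2, mul_pow, div_pow]; field_simp
    _ = (-1)^n * (p/s)^n * r^n * (1 - y^2)^((1:ℝ)/2 - ν) *
        (carK ν n * carD (-1/ν) (n + (ν - 1/2)) n (y * p)) := by rw [F2]; ring
    _ = _ := by ring
end

section
/- Let N > 0 be real and n ∈ ℕ. Let μ be the measure on ℝ with density x ↦ (1 + x²/N)^{−(N+1+n)} · (H_n^N(x))² with respect to Lebesgue measure, and let φ : ℝ → ℝ be the map φ(x) = (x/√N)/√(1 + x²/N). Then the pushforward measure φ_*μ equals (n!)² · N^{1/2−n} times the measure on ℝ with density y ↦ (1 − y²)^{N−1/2} · (C_n^N(y))² · 𝟙_{(−1,1)}(y) with respect to Lebesgue measure. -/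
open Real MeasureTheory Filter

/-! ### Iterated derivatives on an open set -/

lemma hasDerivAt_iter {s : Set ℝ} (hs : IsOpen s) {f : ℝ → ℝ} (hf : ContDiffOn ℝ ⊤ f s)
    (n : ℕ) {y : ℝ} (hy : y ∈ s) :
    HasDerivAt (iteratedDeriv n f) (iteratedDeriv (n + 1) f y) y := by
  rw [iteratedDeriv_succ]
  apply DifferentiableAt.hasDerivAt
  have h1 : DifferentiableWithinAt ℝ (iteratedDerivWithin n f s) s y :=
    (hf.differentiableOn_iteratedDerivWithin (by exact_mod_cast WithTop.coe_lt_top _)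
      hs.uniqueDiffOn) y hy
  have h2 := h1.differentiableAt (hs.mem_nhds hy)
  refine h2.congr_of_eventuallyEq ?_
  filter_upwards [hs.mem_nhds hy] with z hz
  exact (iteratedDerivWithin_of_isOpen hs hz).symm

lemma deriv_eq_of_eqOn {s : Set ℝ} (hs : IsOpen s) {f g : ℝ → ℝ} (h : ∀ y ∈ s, f y = g y)
    {y : ℝ} (hy : y ∈ s) : deriv f y = deriv g y := by
  apply Filter.EventuallyEq.deriv_eq
  filter_upwards [hs.mem_nhds hy] with z hz using h z hz

lemma iter_congr {s : Set ℝ} (hs : IsOpen s) {f g : ℝ → ℝ} (h : ∀ y ∈ s, f y = g y) (n : ℕ) :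
    ∀ y ∈ s, iteratedDeriv n f y = iteratedDeriv n g y := by
  induction n with
  | zero => simpa using h
  | succ n ih =>
    intro y hy
    rw [iteratedDeriv_succ, iteratedDeriv_succ]
    exact deriv_eq_of_eqOn hs ih hy

lemma iter_id_mul {s : Set ℝ} (hs : IsOpen s) {f : ℝ → ℝ} (hf : ContDiffOn ℝ ⊤ f s) (n : ℕ) :
    ∀ y ∈ s, iteratedDeriv (n + 1) (fun t => t * f t) y
      = y * iteratedDeriv (n + 1) f y + (n + 1) * iteratedDeriv n f y := by
  induction n with
  | zero =>
    intro y hy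
    have h := (hasDerivAt_id y).mul (hasDerivAt_iter hs hf 0 hy)
    simp only [iteratedDeriv_zero] at h
    have h2 : deriv (fun t => t * f t) y = _ := h.deriv
    rw [iteratedDeriv_succ, iteratedDeriv_zero, h2]
    simp; ring
  | succ n ih =>
    intro y hy
    rw [iteratedDeriv_succ, deriv_eq_of_eqOn hs ih hy]
    have h := ((hasDerivAt_id y).mul (hasDerivAt_iter hs hf (n + 1) hy)).add
      ((hasDerivAt_iter hs hf n hy).const_mul ((n : ℝ) + 1))
    have h2 : deriv (fun y => y * iteratedDeriv (n + 1) f y + (n + 1) * iteratedDeriv n f y) y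
      = _ := h.deriv
    rw [h2]
    push_cast
    simp only [id]
    ring

lemma iter_w_mul {s : Set ℝ} (hs : IsOpen s) {f : ℝ → ℝ} (hf : ContDiffOn ℝ ⊤ f s) (n : ℕ) :
    ∀ y ∈ s, iteratedDeriv (n + 1) (fun t => (1 - t ^ 2) * f t) y
      = (1 - y ^ 2) * iteratedDeriv (n + 1) f y - (n + 1) * y * iteratedDeriv n f y
        - (n + 1) * iteratedDeriv n (fun t => t * f t) y := by
  have hw : ∀ y : ℝ, HasDerivAt (fun t : ℝ => 1 - t ^ 2) (-(2 * y)) y := fun y => by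
    simpa using (hasDerivAt_pow 2 y).const_sub 1
  have hf' : ContDiffOn ℝ ⊤ (fun t => t * f t) s := contDiffOn_id.mul hf
  induction n with
  | zero =>
    intro y hy
    have h := (hw y).mul (hasDerivAt_iter hs hf 0 hy)
    simp only [iteratedDeriv_zero] at h
    have h2 : deriv (fun t => (1 - t ^ 2) * f t) y = _ := h.deriv
    rw [iteratedDeriv_succ, iteratedDeriv_zero, h2]
    simp; ring
  | succ n ih =>
    intro y hy
    rw [iteratedDeriv_succ, deriv_eq_of_eqOn hs ih hy]
    have h := (((hw y).mul (hasDerivAt_iter hs hf (n + 1) hy)).sub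
      (((hasDerivAt_id y).const_mul ((n : ℝ) + 1)).mul (hasDerivAt_iter hs hf n hy))).sub
      ((hasDerivAt_iter hs hf' n hy).const_mul ((n : ℝ) + 1))
    have h2 : deriv (fun y => (1 - y ^ 2) * iteratedDeriv (n + 1) f y
        - (n + 1) * y * iteratedDeriv n f y
        - (n + 1) * iteratedDeriv n (fun t => t * f t) y) y = _ := h.deriv
    rw [h2]
    have h3 := iter_id_mul hs hf n y hy
    push_cast
    simp only [id]
    linear_combination h3

/-! ### The Gegenbauer ladder -/

lemma w_pos {y : ℝ} (hy : y ∈ Set.Ioo (-1 : ℝ) 1) : 0 < 1 - y ^ 2 := by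
  nlinarith [hy.1, hy.2]

lemma contDiffOn_w (a : ℝ) : ContDiffOn ℝ ⊤ (fun t : ℝ => (1 - t ^ 2) ^ a) (Set.Ioo (-1) 1) := by
  apply ContDiffOn.rpow_const_of_ne
  · fun_prop
  · intro x hx
    exact (w_pos hx).ne'

lemma hasDerivAt_w (a : ℝ) {y : ℝ} (hy : y ∈ Set.Ioo (-1 : ℝ) 1) :
    HasDerivAt (fun t : ℝ => (1 - t ^ 2) ^ a) (-(2 * a) * (y * (1 - y ^ 2) ^ (a - 1))) y := by
  have hw : HasDerivAt (fun t : ℝ => 1 - t ^ 2) (-(2 * y)) y := by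
    simpa using (hasDerivAt_pow 2 y).const_sub 1
  convert hw.rpow_const (p := a) (Or.inl (w_pos hy).ne') using 1
  ring

lemma rodrigues_ladder (n : ℕ) (a : ℝ) {y : ℝ} (hy : y ∈ Set.Ioo (-1 : ℝ) 1) :
    (2 * a + 1 - n) * iteratedDeriv (n + 1) (fun t : ℝ => (1 - t ^ 2) ^ (a + 1)) y
      = -2 * (a + 1) * ((n + 1) * y * iteratedDeriv n (fun t : ℝ => (1 - t ^ 2) ^ a) y
        - (1 - y ^ 2) * iteratedDeriv (n + 1) (fun t : ℝ => (1 - t ^ 2) ^ a) y) := by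
  have hs : IsOpen (Set.Ioo (-1 : ℝ) 1) := isOpen_Ioo
  have h1 : iteratedDeriv (n + 1) (fun t : ℝ => (1 - t ^ 2) ^ (a + 1)) y
      = -(2 * (a + 1)) * iteratedDeriv n (fun t : ℝ => t * (1 - t ^ 2) ^ a) y := by
    rw [iteratedDeriv_succ']
    rw [iter_congr hs (g := fun t => -(2 * (a + 1)) * (t * (1 - t ^ 2) ^ a)) _ n y hy]
    · exact iteratedDeriv_const_mul_field _ _
    · intro z hz
      rw [(hasDerivAt_w (a + 1) hz).deriv]
      simp
  have h2 := iter_w_mul hs (contDiffOn_w a) n y hy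
  rw [iter_congr hs (g := fun t => (1 - t ^ 2) ^ (a + 1)) _ (n + 1) y hy] at h2
  · linear_combination (-(n + 1) : ℝ) * h1 + 2 * (a + 1) * h2
  · intro z hz
    rw [rpow_add_one (w_pos hz).ne', mul_comm]

lemma alpha_succ (n : ℕ) {ν : ℝ} (hν : 0 < ν) :
    (n + 1) * (2 * (ν + 1 / 2 + n)) * alphaConst (n + 1) ν = (2 * ν + n) * alphaConst n ν := by
  unfold alphaConst
  have h1 : 0 < (ascPochhammer ℝ n).eval (ν + 1 / 2) := ascPochhammer_pos n _ (by positivity)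
  have h2 : 0 < ν + 1 / 2 + n := by positivity
  rw [ascPochhammer_succ_eval, ascPochhammer_succ_eval, Nat.factorial_succ]
  push_cast
  have h3 : (0 : ℝ) < n.factorial := by positivity
  generalize (ascPochhammer ℝ n).eval (ν + 1 / 2) = P at *
  generalize ν + 1 / 2 + (n : ℝ) = Q at *
  field_simp
  ring

lemma gegenbauer_hasDerivAt (n : ℕ) {ν : ℝ} (hν : 0 < ν) {y : ℝ}
    (hy : y ∈ Set.Ioo (-1 : ℝ) 1) :
    ∃ c : ℝ, HasDerivAt (gegenbauer n ν) c y ∧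
      (n + 1) * gegenbauer (n + 1) ν y = (n + 2 * ν) * y * gegenbauer n ν y - (1 - y ^ 2) * c := by
  have hs : IsOpen (Set.Ioo (-1 : ℝ) 1) := isOpen_Ioo
  have h := ((hasDerivAt_w (1 / 2 - ν) hy).const_mul (alphaConst n ν * (-1) ^ n)).mul
    (hasDerivAt_iter hs (contDiffOn_w (n + ν - 1 / 2)) n hy)
  refine ⟨_, h, ?_⟩
  have hl := rodrigues_ladder n (n + ν - 1 / 2) hy
  have ha := alpha_succ n hν
  unfold gegenbauer
  have e1 : ((n + 1 : ℕ) : ℝ) + ν - 1 / 2 = (n + ν - 1 / 2) + 1 := by push_cast; ring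
  rw [e1]
  have hw := w_pos hy
  have e2 : (1 - y ^ 2) ^ (1 / 2 - ν) = (1 - y ^ 2) ^ (1 / 2 - ν - 1) * (1 - y ^ 2) := by
    rw [← rpow_add_one hw.ne']; simp
  rw [e2]
  have h2 : 0 < ν + 1 / 2 + n := by positivity
  generalize iteratedDeriv (n + 1) (fun t : ℝ => (1 - t ^ 2) ^ ((n : ℝ) + ν - 1 / 2 + 1)) y = A at *
  generalize iteratedDeriv (n + 1) (fun t : ℝ => (1 - t ^ 2) ^ ((n : ℝ) + ν - 1 / 2)) y = B at *
  generalize iteratedDeriv n (fun t : ℝ => (1 - t ^ 2) ^ ((n : ℝ) + ν - 1 / 2)) y = C at *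
  generalize (1 - y ^ 2) ^ (1 / 2 - ν - 1) = p at *
  generalize alphaConst (n + 1) ν = a1 at *
  generalize alphaConst n ν = a0 at *
  have hne : (2 * (ν + 1 / 2 + n)) ≠ 0 := by positivity
  apply mul_left_cancel₀ hne
  rw [pow_succ]
  linear_combination (-((-1) ^ n * p * (1 - y ^ 2) * A)) * ha
    - (-1) ^ n * p * (1 - y ^ 2) * a0 * hl

/-! ### Relativistic Hermite -/

lemma v_pos {N : ℝ} (hN : 0 < N) (x : ℝ) : 0 < 1 + x ^ 2 / N := by positivity

lemma hasDerivAt_v (N x : ℝ) : HasDerivAt (fun t : ℝ => 1 + t ^ 2 / N) (2 * x / N) x := by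
  simpa using ((hasDerivAt_pow 2 x).div_const N).const_add 1

lemma relHermite_hasDerivAt (n : ℕ) {N : ℝ} (hN : 0 < N) (x : ℝ) :
    ∃ c : ℝ, HasDerivAt (relHermite n N) c x ∧
      relHermite (n + 1) N x = 2 * (N + n) * x / N * relHermite n N x - (1 + x ^ 2 / N) * c := by
  have hv := v_pos hN x
  have hc : ContDiffOn ℝ ⊤ (fun t : ℝ => (1 + t ^ 2 / N) ^ (-N)) Set.univ := by
    apply ContDiffOn.rpow_const_of_ne
    · fun_prop
    · intro z _
      exact (v_pos hN z).ne'
  have h := (((hasDerivAt_v N x).rpow_const (p := N + n) (Or.inl hv.ne')).const_mul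
    ((-1 : ℝ) ^ n)).mul (hasDerivAt_iter isOpen_univ hc n (Set.mem_univ x))
  refine ⟨_, h, ?_⟩
  unfold relHermite
  have e1 : (1 + x ^ 2 / N) ^ (N + ((n + 1 : ℕ) : ℝ))
      = (1 + x ^ 2 / N) ^ (N + n - 1) * (1 + x ^ 2 / N) ^ 2 := by
    rw [← rpow_natCast (1 + x ^ 2 / N) 2, ← rpow_add hv]; push_cast; congr 1; ring
  have e2 : (1 + x ^ 2 / N) ^ (N + (n : ℝ))
      = (1 + x ^ 2 / N) ^ (N + n - 1) * (1 + x ^ 2 / N) := by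
    rw [← rpow_add_one hv.ne']; simp
  rw [e1, e2]
  ring

noncomputable def phi (N x : ℝ) : ℝ := (x / √N) / √(1 + x ^ 2 / N)

lemma one_sub_phi_sq {N : ℝ} (hN : 0 < N) (x : ℝ) :
    1 - phi N x ^ 2 = (1 + x ^ 2 / N)⁻¹ := by
  have hv := v_pos hN x
  unfold phi
  rw [div_pow, div_pow, sq_sqrt hN.le, sq_sqrt hv.le]
  field_simp
  ring

lemma phi_mem {N : ℝ} (hN : 0 < N) (x : ℝ) : phi N x ∈ Set.Ioo (-1 : ℝ) 1 := by
  have h := one_sub_phi_sq hN x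
  have h2 : 0 < (1 + x ^ 2 / N)⁻¹ := inv_pos.2 (v_pos hN x)
  exact abs_lt.1 ((sq_lt_one_iff_abs_lt_one _).1 (by linarith))

lemma hasDerivAt_r {N : ℝ} (hN : 0 < N) (x : ℝ) :
    HasDerivAt (fun t : ℝ => √(1 + t ^ 2 / N)) (x / N / √(1 + x ^ 2 / N)) x := by
  convert (hasDerivAt_v N x).sqrt (v_pos hN x).ne' using 1
  have := sqrt_pos.2 (v_pos hN x)
  field_simp

lemma hasDerivAt_phi {N : ℝ} (hN : 0 < N) (x : ℝ) :
    HasDerivAt (phi N) (1 / (√N * √(1 + x ^ 2 / N) ^ 3)) x := by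
  have hr := sqrt_pos.2 (v_pos hN x)
  have h := ((hasDerivAt_id x).div_const (√N)).div (hasDerivAt_r hN x) hr.ne'
  refine HasDerivAt.congr_deriv h ?_
  have hs := sqrt_pos.2 hN
  have e := sq_sqrt (v_pos hN x).le
  set r := √(1 + x ^ 2 / N)
  simp only [id]
  field_simp
  rw [e]
  field_simp
  ring

lemma key (n : ℕ) {N : ℝ} (hN : 0 < N) : ∀ x : ℝ,
    relHermite n N x = n.factorial * (√(1 + x ^ 2 / N) / √N) ^ n * gegenbauer n N (phi N x) := by
  induction n with
  | zero =>
    intro x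
    have h1 := v_pos hN x
    have h2 := w_pos (phi_mem hN x)
    simp only [relHermite, gegenbauer, alphaConst, iteratedDeriv_zero]
    rw [mul_assoc, ← rpow_add h1, mul_assoc (_ * _) ((1 - phi N x ^ 2) ^ _), ← rpow_add h2]
    simp
  | succ n ih =>
    intro x
    obtain ⟨c, hc, hH⟩ := relHermite_hasDerivAt n hN x
    obtain ⟨d, hd, hG⟩ := gegenbauer_hasDerivAt n hN (phi_mem hN x)
    have hr := sqrt_pos.2 (v_pos hN x)
    have hs := sqrt_pos.2 hN
    have hp := (((hasDerivAt_r hN x).div_const (√N)).pow n).const_mul (n.factorial : ℝ)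
    have h := hp.mul (hd.comp x (hasDerivAt_phi hN x))
    have hfun : relHermite n N = _ := funext ih
    rw [hfun] at hc
    have hcd := hc.unique h
    rw [hH, ih x, hcd]
    have hG' : ((n + 1).factorial : ℝ) * (√(1 + x ^ 2 / N) / √N) ^ (n + 1) *
        gegenbauer (n + 1) N (phi N x) = n.factorial * (√(1 + x ^ 2 / N) / √N) ^ (n + 1) *
        ((n + 2 * N) * phi N x * gegenbauer n N (phi N x) - (1 - phi N x ^ 2) * d) := by
      rw [← hG, Nat.factorial_succ]; push_cast; ring
    rw [hG', one_sub_phi_sq hN]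
    have e := sq_sqrt (v_pos hN x).le
    have e2 := sq_sqrt hN.le
    have hphi : phi N x = x / √N / √(1 + x ^ 2 / N) := rfl
    simp only [Function.comp, Pi.pow_apply]
    generalize gegenbauer n N (phi N x) = C at *
    rw [hphi, ← e]
    simp only [sqrt_sq hr.le]
    generalize √(1 + x ^ 2 / N) = r at *
    rw [← e2]
    simp only [sqrt_sq hs.le]
    generalize √N = s at *
    have hpow : (n : ℝ) * (r / s) ^ (n - 1) = n * (r / s) ^ n * (s / r) := by
      cases n with
      | zero => simp
      | succ m => simp only [Nat.add_sub_cancel, pow_succ]; field_simp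
    rw [hpow, pow_succ (r / s) n]
    generalize (r / s) ^ n = q at *
    field_simp
    ring

lemma phi_strictMono {N : ℝ} (hN : 0 < N) : StrictMono (phi N) := by
  apply strictMono_of_deriv_pos
  intro x
  rw [(hasDerivAt_phi hN x).deriv]
  have hr := sqrt_pos.2 (v_pos hN x)
  have hs := sqrt_pos.2 hN
  positivity

lemma phi_surj {N : ℝ} (hN : 0 < N) {y : ℝ} (hy : y ∈ Set.Ioo (-1 : ℝ) 1) :
    ∃ x, phi N x = y := by
  have hw := w_pos hy
  refine ⟨√N * y / √(1 - y ^ 2), ?_⟩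
  have hs := sqrt_pos.2 hN
  have hq := sqrt_pos.2 hw
  unfold phi
  have e : 1 + (√N * y / √(1 - y ^ 2)) ^ 2 / N = (√(1 - y ^ 2) ^ 2)⁻¹ := by
    rw [div_pow, mul_pow, sq_sqrt hN.le, sq_sqrt hw.le]
    field_simp
    ring
  rw [e, sqrt_inv, sqrt_sq hq.le]
  field_simp

lemma density_eq (n : ℕ) {N : ℝ} (hN : 0 < N) (x : ℝ) :
    (1 + x ^ 2 / N) ^ (-(N + 1 + n)) * (relHermite n N x) ^ 2
      = ((n.factorial : ℝ) ^ 2 * N ^ ((1 : ℝ) / 2 - n)) *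
        (1 / (√N * √(1 + x ^ 2 / N) ^ 3) *
          ((1 - phi N x ^ 2) ^ (N - 1 / 2) * (gegenbauer n N (phi N x)) ^ 2)) := by
  have hv := v_pos hN x
  have hr := sqrt_pos.2 hv
  have hs := sqrt_pos.2 hN
  rw [key n hN, one_sub_phi_sq hN, inv_rpow hv.le, ← rpow_neg hv.le]
  have e1 : N ^ ((1 : ℝ) / 2 - n) = √N / N ^ n := by
    rw [rpow_sub hN, rpow_natCast, sqrt_eq_rpow]
  have e2 : (1 + x ^ 2 / N) ^ (-(N + 1 + n)) * (1 + x ^ 2 / N) ^ n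
      = 1 / √(1 + x ^ 2 / N) ^ 3 * (1 + x ^ 2 / N) ^ (-(N - 1 / 2)) := by
    rw [sqrt_eq_rpow, ← rpow_natCast _ 3, ← rpow_mul hv.le, one_div, ← rpow_neg hv.le,
      ← rpow_add hv, ← rpow_natCast _ n, ← rpow_add hv]
    congr 1
    push_cast
    ring
  have e3 : ((√(1 + x ^ 2 / N) / √N) ^ n) ^ 2 = (1 + x ^ 2 / N) ^ n / N ^ n := by
    rw [← pow_mul, mul_comm, pow_mul, div_pow, sq_sqrt hv.le, sq_sqrt hN.le, div_pow]
  rw [mul_pow, mul_pow, e3, e1]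
  calc _ = ((1 + x ^ 2 / N) ^ (-(N + 1 + n)) * (1 + x ^ 2 / N) ^ n) *
        (n.factorial ^ 2 / N ^ n * gegenbauer n N (phi N x) ^ 2) := by ring
    _ = _ := by
      rw [e2]
      field_simp

theorem relHermite_density_map_eq_gegenbauer_density (N : ℝ) (hN : 0 < N) (n : ℕ) :
    Measure.map (fun x : ℝ => (x / Real.sqrt N) / Real.sqrt (1 + x^2/N))
      (volume.withDensity
        (fun x : ℝ => ENNReal.ofReal ((1 + x^2/N)^(-(N + 1 + n)) * (relHermite n N x)^2)))
    = ENNReal.ofReal (((n.factorial : ℝ))^2 * N^((1:ℝ)/2 - n)) •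
      volume.withDensity
        ((Set.Ioo (-1 : ℝ) 1).indicator
          (fun y : ℝ => ENNReal.ofReal ((1 - y^2)^(N - 1/2) * (gegenbauer n N y)^2))) := by
  change Measure.map (phi N) _ = _
  have hm : Measurable (phi N) := (phi_strictMono hN).monotone.measurable
  ext A hA
  have hpre : MeasurableSet (phi N ⁻¹' A) := hm hA
  rw [Measure.map_apply hm hA, withDensity_apply _ hpre, Measure.smul_apply,
    withDensity_apply _ hA, lintegral_indicator measurableSet_Ioo,
    Measure.restrict_restrict measurableSet_Ioo]
  have himg : Set.Ioo (-1 : ℝ) 1 ∩ A = phi N '' (phi N ⁻¹' A) := by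
    rw [Set.image_preimage_eq_inter_range, Set.inter_comm]
    congr 1
    ext y
    constructor
    · exact fun hy => phi_surj hN hy
    · rintro ⟨x, rfl⟩
      exact phi_mem hN x
  rw [himg, lintegral_image_eq_lintegral_abs_deriv_mul hpre
    (fun x _ => (hasDerivAt_phi hN x).hasDerivWithinAt) (phi_strictMono hN).injective.injOn,
    smul_eq_mul, ← lintegral_const_mul' _ _ ENNReal.ofReal_ne_top]
  congr 1
  ext x
  have hr := sqrt_pos.2 (v_pos hN x)
  have hs := sqrt_pos.2 hN
  have hd : 0 < 1 / (√N * √(1 + x ^ 2 / N) ^ 3) := by positivity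
  have hc : 0 ≤ (n.factorial : ℝ) ^ 2 * N ^ ((1 : ℝ) / 2 - n) := by positivity
  rw [density_eq n hN, abs_of_pos hd, ENNReal.ofReal_mul hc, ENNReal.ofReal_mul hd.le]
end

section
/- Let N > 0 be real and m, n ∈ ℕ. Then ∫_{−∞}^{+∞} H_n^N(X) · H_m^N(X) · (1 + X²/N)^{−N−1−(m+n)/2} dX = [ √(Nπ) · n! · Γ(2N+n) · Γ(N+1/2) / ( (n+N) · Nⁿ · Γ(2N) · Γ(N) ) ] · δ_{m,n}, where δ_{m,n} is the Kronecker delta; in particular the integral vanishes when m ≠ n. -/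
open Real MeasureTheory Filter

/-! ### The Gegenbauer-type polynomials in `u = X / √(N + X²)` -/

namespace RelHermiteAux

open Polynomial in
/-- Rescaled Gegenbauer polynomials `n! C_n^N`. -/
noncomputable def Q (N : ℝ) : ℕ → Polynomial ℝ
  | 0 => 1
  | n + 1 => C (2 * N + n) * X * Q N n - (1 - X ^ 2) * derivative (Q N n)

section poly
open Polynomial

lemma Q_zero (N : ℝ) : Q N 0 = 1 := rfl

lemma Q_succ (N : ℝ) (n : ℕ) :
    Q N (n + 1) = C (2 * N + n) * X * Q N n - (1 - X ^ 2) * derivative (Q N n) := rfl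

lemma Q_lower (N : ℝ) (n : ℕ) :
    (1 - X ^ 2) * derivative (Q N (n + 1)) =
      - ((n : ℝ[X]) + 1) * X * Q N (n + 1) + ((n : ℝ[X]) + 1) * ((n : ℝ[X]) + 2 * C N) * Q N n := by
  induction n with
  | zero =>
    simp only [Q_succ, Q_zero, map_add, map_mul, map_natCast, map_ofNat, derivative_one,
      derivative_mul, derivative_X, derivative_C, derivative_sub, derivative_ofNat, map_zero,
      Nat.cast_zero, mul_zero, sub_zero, mul_one, zero_mul, add_zero, zero_add]
    ring
  | succ n ih =>
    have e : Q N (n + 2) = 2 * (C N + (n : ℝ[X]) + 1) * X * Q N (n + 1)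
        - ((n : ℝ[X]) + 1) * ((n : ℝ[X]) + 2 * C N) * Q N n := by
      rw [Q_succ N (n + 1), ih]
      simp only [map_add, map_mul, map_natCast, map_ofNat]
      push_cast
      ring
    have h0 := Q_succ N n
    simp only [map_add, map_mul, map_natCast, map_ofNat] at h0
    have e' : derivative (Q N (n + 2)) = 2 * (C N + (n : ℝ[X]) + 1) * (Q N (n + 1) +
        X * derivative (Q N (n + 1))) - ((n : ℝ[X]) + 1) * ((n : ℝ[X]) + 2 * C N) * derivative (Q N n) := by
      rw [e]
      simp only [derivative_sub, derivative_mul, derivative_add, derivative_X, derivative_C,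
        derivative_natCast, derivative_ofNat, derivative_one]
      ring
    show (1 - X ^ 2) * derivative (Q N (n + 2)) = _
    rw [e', show n + 1 + 1 = n + 2 from rfl, e]
    push_cast
    linear_combination (2 * (C N + (n : ℝ[X]) + 1) * X) * ih - (((n : ℝ[X]) + 1) * ((n : ℝ[X]) + 2 * C N) : ℝ[X]) * h0

lemma Q_three (N : ℝ) (n : ℕ) :
    Q N (n + 2) = 2 * (C N + (n : ℝ[X]) + 1) * X * Q N (n + 1) - ((n : ℝ[X]) + 1) * ((n : ℝ[X]) + 2 * C N) * Q N n := by
  rw [Q_succ N (n + 1), Q_lower]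
  simp only [map_add, map_mul, map_natCast, map_ofNat]
  push_cast
  ring

lemma one_sub_ne : (1 - X ^ 2 : ℝ[X]) ≠ 0 := by
  intro h
  have := congrArg (eval 0) h
  simp at this

lemma Q_deriv_succ (N : ℝ) (n : ℕ) :
    derivative (Q N (n + 1)) =
      ((n : ℝ[X]) + 1) * X * derivative (Q N n) + ((n : ℝ[X]) + 1) * ((n : ℝ[X]) + 2 * C N) * Q N n := by
  apply mul_left_cancel₀ one_sub_ne
  have h0 := Q_succ N n
  simp only [map_add, map_mul, map_natCast, map_ofNat] at h0
  rw [Q_lower]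
  linear_combination (- ((n : ℝ[X]) + 1) * X) * h0

lemma Q_ode (N : ℝ) (n : ℕ) :
    (1 - X ^ 2) * derivative (derivative (Q N n)) =
      (2 * C N + 1) * X * derivative (Q N n) - (n : ℝ[X]) * ((n : ℝ[X]) + 2 * C N) * Q N n := by
  have h := Q_deriv_succ N n
  rw [Q_succ] at h
  simp only [map_add, map_mul, map_natCast, map_ofNat, derivative_sub, derivative_mul,
    derivative_add, derivative_X, derivative_natCast, derivative_ofNat, derivative_one,
    derivative_C, derivative_pow] at h
  linear_combination (-1 : ℝ[X]) * h

end poly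

/-! ### Analysis -/

/-- `1 + X²/N` -/
noncomputable def s (N X : ℝ) : ℝ := 1 + X ^ 2 / N

/-- `X / √(N + X²)` -/
noncomputable def u (N X : ℝ) : ℝ := (√N)⁻¹ * X * (s N X) ^ (-(1/2) : ℝ)

variable {N : ℝ}

lemma s_pos (hN : 0 < N) (X : ℝ) : 0 < s N X := by unfold s; positivity

lemma s_rpow_neg_one (hN : 0 < N) (X : ℝ) : (s N X) ^ (-1 : ℝ) = 1 - (u N X) ^ 2 := by
  have h := s_pos hN X
  have h2 : ((s N X) ^ (-(1/2) : ℝ)) ^ 2 = (s N X)⁻¹ := by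
    rw [← Real.rpow_natCast, ← Real.rpow_mul h.le, ← Real.rpow_neg_one]
    norm_num
  unfold u
  rw [mul_pow, mul_pow, h2, inv_pow, Real.sq_sqrt hN.le, Real.rpow_neg_one]
  field_simp
  unfold s
  field_simp
  ring

lemma u_abs_le (hN : 0 < N) (X : ℝ) : u N X ∈ Set.Icc (-1 : ℝ) 1 := by
  have h := s_rpow_neg_one hN X
  have h2 : 0 < (s N X) ^ (-1 : ℝ) := Real.rpow_pos_of_pos (s_pos hN X) _
  constructor <;> nlinarith

lemma hasDerivAt_s (X : ℝ) : HasDerivAt (s N) (2 * X / N) X := by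
  unfold s
  have := ((hasDerivAt_pow 2 X).div_const N).const_add 1
  simpa using this

lemma s_deriv_eq (hN : 0 < N) (X : ℝ) :
    2 * X / N = 2 * (√N)⁻¹ * u N X * (s N X) ^ (1/2 : ℝ) := by
  have h := s_pos hN X
  have h3 : (s N X) ^ (-(1/2) : ℝ) * (s N X) ^ (1/2 : ℝ) = 1 := by
    rw [← Real.rpow_add h]; norm_num
  have h4 : (√N)⁻¹ * (√N)⁻¹ = N⁻¹ := by
    rw [← mul_inv, Real.mul_self_sqrt hN.le]
  unfold u
  rw [div_eq_mul_inv, ← h4]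
  linear_combination (-2 * X * ((√N)⁻¹ * (√N)⁻¹)) * h3

lemma hasDerivAt_s_rpow (hN : 0 < N) (a X : ℝ) :
    HasDerivAt (fun X => (s N X) ^ (-a)) (-(2 * a) * (√N)⁻¹ * u N X * (s N X) ^ (-a - 1/2)) X := by
  have h := (hasDerivAt_s (N := N) X).rpow_const (p := -a) (Or.inl (s_pos hN X).ne')
  convert h using 1
  rw [s_deriv_eq hN, show -a - 1/2 = 1/2 + (-a - 1) by ring, Real.rpow_add (s_pos hN X)]
  ring

lemma hasDerivAt_u (hN : 0 < N) (X : ℝ) :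
    HasDerivAt (u N) ((√N)⁻¹ * (s N X) ^ (-(1/2) : ℝ) * (1 - u N X ^ 2)) X := by
  have h := ((hasDerivAt_id X).const_mul (√N)⁻¹).mul (hasDerivAt_s_rpow hN (1/2) X)
  have h5 : (s N X) ^ (-(1/2) - 1/2 : ℝ) = (s N X) ^ (-(1/2) : ℝ) * (s N X) ^ (-(1/2) : ℝ) := by
    rw [← Real.rpow_add (s_pos hN X)]; norm_num
  refine HasDerivAt.congr_deriv (f := u N) h ?_
  simp only [id]
  rw [h5]
  unfold u
  ring

lemma hasDerivAt_main (hN : 0 < N) (a : ℝ) (p : Polynomial ℝ) (X : ℝ) :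
    HasDerivAt (fun X => (s N X) ^ (-a) * p.eval (u N X))
      ((√N)⁻¹ * ((s N X) ^ (-a - 1/2) * (-(2 * a) * u N X * p.eval (u N X) +
        (1 - u N X ^ 2) * p.derivative.eval (u N X)))) X := by
  have h := (hasDerivAt_s_rpow hN a X).mul
    (HasDerivAt.comp X (p.hasDerivAt (u N X)) (hasDerivAt_u hN X))
  have h5 : (s N X) ^ (-a - 1/2) = (s N X) ^ (-a) * (s N X) ^ (-(1/2) : ℝ) := by
    rw [← Real.rpow_add (s_pos hN X)]; norm_num [sub_eq_add_neg]
  refine HasDerivAt.congr_deriv (f := fun X => (s N X) ^ (-a) * p.eval (u N X)) h ?_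
  simp only [Function.comp]
  rw [h5]
  ring

lemma iteratedDeriv_eq (hN : 0 < N) (n : ℕ) :
    iteratedDeriv n (fun t : ℝ => (1 + t^2/N)^(-N)) =
      fun X => (-1) ^ n * (√N)⁻¹ ^ n * ((s N X) ^ (-(N + n / 2)) * (Q N n).eval (u N X)) := by
  induction n with
  | zero => funext X; simp [Q_zero, s]
  | succ n ih =>
    rw [iteratedDeriv_succ, ih]
    funext X
    rw [((hasDerivAt_main hN (N + n / 2) (Q N n) X).const_mul _).deriv, Q_succ]
    rw [show -(N + ((n + 1 : ℕ) : ℝ) / 2) = -(N + n / 2) - 1 / 2 by push_cast; ring]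
    simp
    ring

lemma relHermite_eq (hN : 0 < N) (n : ℕ) (X : ℝ) :
    relHermite n N X = (√N)⁻¹ ^ n * ((s N X) ^ ((n : ℝ) / 2) * (Q N n).eval (u N X)) := by
  unfold relHermite
  rw [iteratedDeriv_eq hN]
  change (-1) ^ n * (s N X) ^ (N + (n : ℝ)) * _ = _
  have h1 : ((-1 : ℝ) ^ n) * (-1) ^ n = 1 := by
    rw [← mul_pow]; norm_num
  have h2 : (s N X) ^ (N + (n : ℝ)) * (s N X) ^ (-(N + n / 2)) = (s N X) ^ ((n : ℝ) / 2) := by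
    rw [← Real.rpow_add (s_pos hN X)]; congr 1; ring
  rw [← h2]
  linear_combination ((s N X) ^ (N + (n : ℝ)) * (s N X) ^ (-(N + n / 2)) * (√N)⁻¹ ^ n *
    (Q N n).eval (u N X)) * h1

lemma continuous_s : Continuous (s N) := by unfold s; fun_prop

lemma continuous_s_rpow (hN : 0 < N) (a : ℝ) : Continuous (fun X => (s N X) ^ a) :=
  continuous_s.rpow_const (fun X => Or.inl (s_pos hN X).ne')

lemma continuous_u (hN : 0 < N) : Continuous (u N) := by
  unfold u
  exact (continuous_const.mul continuous_id).mul (continuous_s_rpow hN _)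

lemma poly_bound (hN : 0 < N) (p : Polynomial ℝ) : ∃ C, ∀ X, ‖p.eval (u N X)‖ ≤ C := by
  obtain ⟨C, hC⟩ := isCompact_Icc.exists_bound_of_continuousOn
    (p.continuous.continuousOn (s := Set.Icc (-1 : ℝ) 1))
  exact ⟨C, fun X => hC _ (u_abs_le hN X)⟩

lemma integrable_s (hN : 0 < N) {a : ℝ} (ha : 1 / 2 < a) :
    Integrable (fun X => (s N X) ^ (-a)) := by
  have h := integrable_rpow_neg_one_add_norm_sq (E := ℝ) (μ := volume) (r := 2 * a)
    (by simp; linarith)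
  have h2 := h.comp_mul_left' (R := (√N)⁻¹) (by positivity)
  convert h2 using 2 with X
  unfold s
  rw [Real.norm_eq_abs, sq_abs, mul_pow, inv_pow, Real.sq_sqrt hN.le]
  congr 1
  · ring
  · ring

lemma integrable_poly (hN : 0 < N) (p : Polynomial ℝ) :
    Integrable (fun X => (s N X) ^ (-N - 1) * p.eval (u N X)) := by
  obtain ⟨C, hC⟩ := poly_bound hN p
  have h := integrable_s hN (a := N + 1) (by linarith)
  rw [show -(N + 1) = -N - 1 by ring] at h
  exact h.mul_bdd (c := C) (p.continuous.comp (continuous_u hN)).aestronglyMeasurable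
    (Filter.Eventually.of_forall hC)

/-- The moment functional. -/
noncomputable def L (N : ℝ) (p : Polynomial ℝ) : ℝ :=
  ∫ X : ℝ, (s N X) ^ (-N - 1) * p.eval (u N X)

lemma L_add (hN : 0 < N) (p q : Polynomial ℝ) : L N (p + q) = L N p + L N q := by
  unfold L
  rw [← integral_add (integrable_poly hN p) (integrable_poly hN q)]
  simp [mul_add]

lemma L_smul (c : ℝ) (p : Polynomial ℝ) : L N (Polynomial.C c * p) = c * L N p := by
  unfold L
  rw [← integral_const_mul]
  congr 1; funext X; simp; ring

lemma tendsto_s_top (hN : 0 < N) : Tendsto (s N) atTop atTop := by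
  unfold s
  exact tendsto_atTop_add_const_left _ _ ((tendsto_pow_atTop two_ne_zero).atTop_div_const hN)

lemma tendsto_s_bot (hN : 0 < N) : Tendsto (s N) atBot atTop := by
  have := (tendsto_s_top hN).comp tendsto_neg_atBot_atTop
  convert this using 1
  funext X; simp [s]

lemma tendsto_zero (hN : 0 < N) {l : Filter ℝ} (hl : Tendsto (s N) l atTop) {a : ℝ} (ha : 0 < a)
    (p : Polynomial ℝ) : Tendsto (fun X => (s N X) ^ (-a) * p.eval (u N X)) l (nhds 0) := by
  obtain ⟨C, hC⟩ := poly_bound hN p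
  have h := (tendsto_rpow_neg_atTop ha).comp hl
  exact h.zero_mul_isBoundedUnder_le (Filter.isBoundedUnder_of ⟨C, hC⟩)

lemma L_parts (hN : 0 < N) (p : Polynomial ℝ) :
    L N ((1 - Polynomial.X ^ 2) * p.derivative
      - Polynomial.C (2 * N + 1) * Polynomial.X * p) = 0 := by
  have key : ∀ X, (√N)⁻¹ * ((s N X) ^ (-(N + 1/2) - 1/2) * (-(2 * (N + 1/2)) * u N X *
      p.eval (u N X) + (1 - u N X ^ 2) * p.derivative.eval (u N X))) =
      (√N)⁻¹ * ((s N X) ^ (-N - 1) * Polynomial.eval (u N X) ((1 - Polynomial.X ^ 2) * p.derivative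
      - Polynomial.C (2 * N + 1) * Polynomial.X * p)) := by
    intro X
    rw [show -(N + 1/2) - 1/2 = -N - 1 by ring]
    simp
    left; left; ring
  have h := integral_of_hasDerivAt_of_tendsto
    (fun X => (key X) ▸ hasDerivAt_main hN (N + 1/2) p X)
    ((integrable_poly hN _).const_mul _)
    (tendsto_zero hN (tendsto_s_bot hN) (by linarith) p)
    (tendsto_zero hN (tendsto_s_top hN) (by linarith) p)
  rw [integral_const_mul, sub_zero] at h
  rcases mul_eq_zero.1 h with h | h
  · have : 0 < (√N)⁻¹ := by positivity
    exact absurd h this.ne'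
  · exact h

lemma L_orth (hN : 0 < N) {m n : ℕ} (hmn : m ≠ n) : L N (Q N n * Q N m) = 0 := by
  have h := L_parts hN ((Q N n).derivative * Q N m - Q N n * (Q N m).derivative)
  have e : (1 - Polynomial.X ^ 2) * ((Q N n).derivative * Q N m
      - Q N n * (Q N m).derivative).derivative
      - Polynomial.C (2 * N + 1) * Polynomial.X * ((Q N n).derivative * Q N m
      - Q N n * (Q N m).derivative) =
      Polynomial.C (((m : ℝ) - n) * (m + n + 2 * N)) * (Q N n * Q N m) := by
    have h1 := Q_ode N n
    have h2 := Q_ode N m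
    simp only [map_add, map_mul, map_natCast, map_ofNat, map_one, map_sub,
      Polynomial.derivative_sub, Polynomial.derivative_mul]
    linear_combination Q N m * h1 - Q N n * h2
  rw [e, L_smul] at h
  have h1 : (m : ℝ) - n ≠ 0 := sub_ne_zero.2 (by exact_mod_cast hmn)
  have h2 : (m : ℝ) + n + 2 * N ≠ 0 := by positivity
  simpa [h1, h2] using h

lemma L_norm_succ (hN : 0 < N) (n : ℕ) :
    ((n : ℝ) + 1 + N) * L N (Q N (n + 1) * Q N (n + 1)) =
      (N + n) * (n + 1) * (n + 2 * N) * L N (Q N n * Q N n) := by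
  have hA : L N (Q N (n + 1) * Q N (n + 1)) =
      2 * (N + n) * L N (Polynomial.X * Q N n * Q N (n + 1)) := by
    cases n with
    | zero =>
      rw [← L_smul]
      congr 1
      simp [Q_succ, Q_zero]
      ring
    | succ k =>
      have e : Q N (k + 2) * Q N (k + 2) =
          Polynomial.C (2 * (N + (k + 1 : ℕ))) * (Polynomial.X * Q N (k + 1) * Q N (k + 2)) +
          Polynomial.C (-((k + 1) * (k + 2 * N))) * (Q N k * Q N (k + 2)) := by
        conv_lhs => lhs; rw [Q_three]
        simp only [map_add, map_mul, map_natCast, map_ofNat, map_one, map_neg]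
        push_cast
        ring
      show L N (Q N (k + 2) * Q N (k + 2)) = _
      rw [e, L_add hN, L_smul, L_smul, L_orth hN (m := k + 2) (n := k) (by omega)]
      push_cast
      ring
  have hB : 0 = 2 * (N + n + 1) * L N (Polynomial.X * Q N n * Q N (n + 1)) -
      (n + 1) * (n + 2 * N) * L N (Q N n * Q N n) := by
    have e : Q N (n + 2) * Q N n =
        Polynomial.C (2 * (N + n + 1)) * (Polynomial.X * Q N n * Q N (n + 1)) +
        Polynomial.C (-((n + 1) * (n + 2 * N))) * (Q N n * Q N n) := by
      rw [Q_three]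
      simp only [map_add, map_mul, map_natCast, map_ofNat, map_one, map_neg]
      ring
    have h := L_orth hN (m := n) (n := n + 2) (by omega)
    rw [e, L_add hN, L_smul, L_smul] at h
    linear_combination -h
  rw [hA]
  linear_combination (-(N + n)) * hB

lemma L_base (hN : 0 < N) :
    Real.Gamma (N + 1) * ∫ X : ℝ, (s N X) ^ (-(N + 1)) = √(N * π) * Real.Gamma (N + 1/2) := by
  have inner : ∀ X, ∫ t in Set.Ioi (0:ℝ), t ^ N * Real.exp (-(s N X * t)) =
      Real.Gamma (N + 1) * (s N X) ^ (-(N + 1)) := by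
    intro X
    have h := Real.integral_rpow_mul_exp_neg_mul_Ioi (a := N + 1) (r := s N X) (by linarith)
      (s_pos hN X)
    rw [add_sub_cancel_right] at h
    rw [h, one_div, Real.inv_rpow (s_pos hN X).le, Real.rpow_neg (s_pos hN X).le]
    ring
  have inner_int : ∀ X, Integrable (fun t : ℝ => t ^ N * Real.exp (-(s N X * t)))
      (volume.restrict (Set.Ioi 0)) := by
    intro X
    by_contra h
    have h1 := inner X
    rw [integral_undef h] at h1
    have : 0 < Real.Gamma (N + 1) * (s N X) ^ (-(N + 1)) :=
      mul_pos (Real.Gamma_pos_of_pos (by linarith)) (Real.rpow_pos_of_pos (s_pos hN X) _)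
    linarith
  have hint : Integrable (Function.uncurry fun (X t : ℝ) => t ^ N * Real.exp (-(s N X * t)))
      (volume.prod (volume.restrict (Set.Ioi 0))) := by
    rw [integrable_prod_iff]
    · refine ⟨Filter.Eventually.of_forall inner_int, ?_⟩
      have : (fun X => ∫ t in Set.Ioi (0:ℝ), ‖t ^ N * Real.exp (-(s N X * t))‖) =
          fun X => Real.Gamma (N + 1) * (s N X) ^ (-(N + 1)) := by
        funext X
        rw [← inner X]
        refine setIntegral_congr_fun measurableSet_Ioi fun t ht => ?_
        have ht' : (0:ℝ) < t := ht
        exact Real.norm_of_nonneg (by positivity)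
      simp only [Function.uncurry]
      rw [this]
      exact (integrable_s hN (by linarith)).const_mul _
    · apply Measurable.aestronglyMeasurable
      unfold s
      simp only [Function.uncurry_def]
      fun_prop
  have hswap := integral_integral_swap hint
  simp only [inner] at hswap
  rw [integral_const_mul] at hswap
  rw [hswap]
  have h2 : ∀ t ∈ Set.Ioi (0:ℝ), ∫ X : ℝ, t ^ N * Real.exp (-(s N X * t)) =
      √(N * π) * (t ^ (N + 1/2 - 1) * Real.exp (-(1 * t))) := by
    intro t ht
    have ht' : (0:ℝ) < t := ht
    have e : (fun X : ℝ => t ^ N * Real.exp (-(s N X * t))) =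
        fun X => (t ^ N * Real.exp (-t)) * Real.exp (-(t / N) * X ^ 2) := by
      funext X
      rw [mul_assoc, ← Real.exp_add]
      congr 2
      unfold s
      ring
    rw [e, integral_const_mul, integral_gaussian]
    rw [show π / (t / N) = (N * π) * t⁻¹ by field_simp, Real.sqrt_mul (by positivity),
      show N + 1/2 - 1 = N + -(1/2) by ring, Real.rpow_add ht', Real.rpow_neg ht'.le,
      ← Real.sqrt_eq_rpow, Real.sqrt_inv]
    simp only [one_mul]
    ring
  rw [setIntegral_congr_fun measurableSet_Ioi h2, integral_const_mul,
    Real.integral_rpow_mul_exp_neg_mul_Ioi (by linarith) one_pos]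
  simp

lemma L_norm (hN : 0 < N) (n : ℕ) :
    L N (Q N n * Q N n) = √(N * π) * (n.factorial : ℝ) * Real.Gamma (2*N + n) *
            Real.Gamma (N + 1/2) /
            (((n : ℝ) + N) * Real.Gamma (2*N) * Real.Gamma N) := by
  have g1 : Real.Gamma (2 * N) ≠ 0 := (Real.Gamma_pos_of_pos (by linarith)).ne'
  have g2 : Real.Gamma N ≠ 0 := (Real.Gamma_pos_of_pos hN).ne'
  induction n with
  | zero =>
    have h := L_base hN
    rw [Real.Gamma_add_one hN.ne'] at h
    have e : L N (Q N 0 * Q N 0) = ∫ X : ℝ, (s N X) ^ (-(N + 1)) := by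
      unfold L
      simp only [Q_zero]
      rw [show -(N + 1) = -N - 1 by ring]
      simp
    rw [e]
    simp only [Nat.factorial_zero, Nat.cast_one, Nat.cast_zero, add_zero, zero_add]
    rw [eq_div_iff (by positivity)]
    linear_combination Real.Gamma (2 * N) * h
  | succ n ih =>
    have h := L_norm_succ hN n
    rw [ih] at h
    have p1 : (n : ℝ) + 1 + N ≠ 0 := by positivity
    have p2 : (n : ℝ) + N ≠ 0 := by positivity
    have p3 : 2 * N + (n : ℝ) ≠ 0 := by positivity
    have g3 : Real.Gamma (2 * N + ((n + 1 : ℕ) : ℝ)) = (2 * N + n) * Real.Gamma (2 * N + n) := by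
      rw [← Real.Gamma_add_one p3]; push_cast; ring_nf
    rw [g3, Nat.factorial_succ]
    apply mul_left_cancel₀ p1
    rw [h]
    push_cast
    field_simp
    ring

end RelHermiteAux

theorem relHermite_orthogonality (N : ℝ) (hN : 0 < N) (m n : ℕ) :
    ∫ X : ℝ, relHermite n N X * relHermite m N X *
        (1 + X^2/N)^(-N - 1 - ((m : ℝ) + n)/2)
      = if m = n then
          Real.sqrt (N * Real.pi) * (n.factorial : ℝ) * Real.Gamma (2*N + n) *
            Real.Gamma (N + 1/2) /
            (((n : ℝ) + N) * N^n * Real.Gamma (2*N) * Real.Gamma N)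
        else 0 := by
  have e : ∀ X : ℝ, relHermite n N X * relHermite m N X *
        (1 + X^2/N)^(-N - 1 - ((m : ℝ) + n)/2) = ((√N)⁻¹ ^ n * (√N)⁻¹ ^ m) *
        ((RelHermiteAux.s N X) ^ (-N - 1) *
          (RelHermiteAux.Q N n * RelHermiteAux.Q N m).eval (RelHermiteAux.u N X)) := by
    intro X
    have h : (RelHermiteAux.s N X) ^ ((n : ℝ) / 2) * (RelHermiteAux.s N X) ^ ((m : ℝ) / 2) *
        (RelHermiteAux.s N X) ^ (-N - 1 - ((m : ℝ) + n)/2) = (RelHermiteAux.s N X) ^ (-N - 1) := by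
      rw [← Real.rpow_add (RelHermiteAux.s_pos hN X), ← Real.rpow_add (RelHermiteAux.s_pos hN X)]
      congr 1
      ring
    rw [RelHermiteAux.relHermite_eq hN, RelHermiteAux.relHermite_eq hN, Polynomial.eval_mul, ← h]
    change _ * (RelHermiteAux.s N X) ^ (-N - 1 - ((m : ℝ) + n)/2) = _
    ring
  simp only [e]
  rw [integral_const_mul]
  change _ * RelHermiteAux.L N (RelHermiteAux.Q N n * RelHermiteAux.Q N m) = _
  split_ifs with hmn
  · subst hmn
    have h4 : (√N)⁻¹ ^ m * (√N)⁻¹ ^ m = (N ^ m)⁻¹ := by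
      rw [← mul_pow, ← mul_inv, Real.mul_self_sqrt hN.le, inv_pow]
    rw [h4, RelHermiteAux.L_norm hN]
    have g1 : Real.Gamma (2 * N) ≠ 0 := (Real.Gamma_pos_of_pos (by linarith)).ne'
    have g2 : Real.Gamma N ≠ 0 := (Real.Gamma_pos_of_pos hN).ne'
    have p2 : (m : ℝ) + N ≠ 0 := by positivity
    field_simp
  · rw [RelHermiteAux.L_orth hN hmn, mul_zero]
end
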